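/- arXiv:2601.22847 — 6 statements merged into one kernel-verified Lean document; each statement's English description precedes it below -/
import Mathlib

section
/- Let d ≥ 1 and let z : ℝᵈ → ℝᵈ be a C² ℤᵈ-periodic vector field. Then ∫ (div z)⁴ ≤ 9 · (sup_{x ∈ ℝᵈ} |z(x)|)² · ∫ |∇(div z)|². -/
open MeasureTheory
open scoped RealInnerProductSpace

noncomputable section

/-- The fundamental domain `[0,1)^d` of the torus, inside `ℝ^d`. -/
def UnitCube (d : ℕ) : Set (EuclideanSpace ℝ (Fin d)) :=
  {x | ∀ i, 0 ≤ x i ∧ x i < 1}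

/-- A function on `ℝ^d` is `ℤ^d`-periodic if it is invariant under translations by
integer vectors. -/
def ZdPeriodic {d : ℕ} {V : Type*} (f : EuclideanSpace ℝ (Fin d) → V) : Prop :=
  ∀ (x : EuclideanSpace ℝ (Fin d)) (m : Fin d → ℤ),
    f (x + (EuclideanSpace.equiv (Fin d) ℝ).symm (fun i => (m i : ℝ))) = f x

/-- The divergence of a vector field on `ℝ^d`. -/
noncomputable def diverg {d : ℕ}
    (z : EuclideanSpace ℝ (Fin d) → EuclideanSpace ℝ (Fin d))
    (x : EuclideanSpace ℝ (Fin d)) : ℝ :=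
  ∑ i, fderiv ℝ z x (EuclideanSpace.single i 1) i


lemma aux_cube_eq (d : ℕ) : UnitCube d =
    (WithLp.ofLp : EuclideanSpace ℝ (Fin d) → (Fin d → ℝ)) ⁻¹'
      (Set.univ.pi fun _ => Set.Ico (0:ℝ) 1) := by
  ext x
  simp [UnitCube]

def KCube (d : ℕ) : Set (EuclideanSpace ℝ (Fin d)) :=
  (WithLp.toLp 2 : (Fin d → ℝ) → EuclideanSpace ℝ (Fin d)) '' Set.Icc 0 1

lemma aux_K_compact (d : ℕ) : IsCompact (KCube d) :=
  isCompact_Icc.image (PiLp.continuous_toLp 2 _)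

lemma aux_cube_sub (d : ℕ) : UnitCube d ⊆ KCube d := by
  intro x hx
  exact ⟨WithLp.ofLp x, ⟨fun i => (hx i).1, fun i => (hx i).2.le⟩, rfl⟩

lemma aux_integrable {d : ℕ} {g : EuclideanSpace ℝ (Fin d) → ℝ} (hg : Continuous g) :
    IntegrableOn g (UnitCube d) :=
  (hg.continuousOn.integrableOn_compact (aux_K_compact d)).mono_set (aux_cube_sub d)

lemma aux_cube_integral {d : ℕ} (g : EuclideanSpace ℝ (Fin d) → ℝ) :
    ∫ x in UnitCube d, g x = ∫ x in Set.Icc (0 : Fin d → ℝ) 1, g (WithLp.toLp 2 x) := by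
  rw [volume_pi, ← setIntegral_congr_set Measure.univ_pi_Ico_ae_eq_Icc, ← volume_pi]
  rw [aux_cube_eq]
  have h := (PiLp.volume_preserving_ofLp (Fin d)).setIntegral_preimage_emb
    (MeasurableEquiv.toLp 2 (Fin d → ℝ)).symm.measurableEmbedding
    (fun x => g (WithLp.toLp 2 x)) (Set.univ.pi fun _ => Set.Ico (0:ℝ) 1)
  simpa using h

lemma aux_div_zero {d : ℕ} (hd : 1 ≤ d)
    {F : EuclideanSpace ℝ (Fin d) → EuclideanSpace ℝ (Fin d)}
    (hF : ContDiff ℝ 1 F) (hp : ZdPeriodic F) :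
    ∫ x in UnitCube d, diverg F x = 0 := by
  obtain ⟨n, rfl⟩ : ∃ n, d = n + 1 := ⟨d - 1, by omega⟩
  rw [aux_cube_integral]
  have hcont : Continuous (fun x : Fin (n+1) → ℝ => diverg F (WithLp.toLp 2 x)) := by
    unfold diverg
    have := hF.continuous_fderiv (by norm_num)
    fun_prop
  have key := integral_divergence_of_hasFDerivAt_off_countable'
    (0 : Fin (n+1) → ℝ) 1 (fun _ => zero_le_one)
    (fun i x => F (WithLp.toLp 2 x) i)
    (fun i x => (EuclideanSpace.proj i : EuclideanSpace ℝ (Fin (n+1)) →L[ℝ] ℝ) ∘L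
      (fderiv ℝ F (WithLp.toLp 2 x)) ∘L
        ((EuclideanSpace.equiv (Fin (n+1)) ℝ).symm : (Fin (n+1) → ℝ) →L[ℝ] _))
    ∅ Set.countable_empty ?_ ?_ ?_
  · have e : ∀ x : Fin (n+1) → ℝ, diverg F (WithLp.toLp 2 x) =
      ∑ i, ((EuclideanSpace.proj i : EuclideanSpace ℝ (Fin (n+1)) →L[ℝ] ℝ) ∘L
      (fderiv ℝ F (WithLp.toLp 2 x)) ∘L
        ((EuclideanSpace.equiv (Fin (n+1)) ℝ).symm : (Fin (n+1) → ℝ) →L[ℝ] _)) (Pi.single i 1) := by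
      intro x
      rfl
    simp_rw [e]
    rw [key]
    refine Finset.sum_eq_zero fun i _ => ?_
    rw [sub_eq_zero]
    congr 1
    ext x
    have := hp (WithLp.toLp 2 (i.insertNth 0 x)) (Pi.single i 1)
    have e2 : (WithLp.toLp 2 (i.insertNth (0:ℝ) x : Fin (n+1) → ℝ) : EuclideanSpace ℝ (Fin (n+1))) +
        (EuclideanSpace.equiv (Fin (n+1)) ℝ).symm (fun j => (((Pi.single i 1 : Fin (n+1) → ℤ) j : ℤ) : ℝ))
        = WithLp.toLp 2 (i.insertNth (1:ℝ) x : Fin (n+1) → ℝ) := by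
      ext j
      refine Fin.succAboveCases i ?_ (fun k => ?_) j
      · simp
      · simp
    rw [e2] at this
    simp only [Pi.one_apply, Pi.zero_apply]
    rw [this]
  · intro i
    have := hF.continuous
    exact Continuous.continuousOn (by fun_prop)
  · intro x _ i
    have h1 : HasFDerivAt (fun x : Fin (n+1) → ℝ => (WithLp.toLp 2 x : EuclideanSpace ℝ (Fin (n+1))))
        ((EuclideanSpace.equiv (Fin (n+1)) ℝ).symm : (Fin (n+1) → ℝ) →L[ℝ] _) x :=
      (EuclideanSpace.equiv (Fin (n+1)) ℝ).symm.hasFDerivAt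
    have h2 := ((hF.differentiable (by norm_num)) (WithLp.toLp 2 x)).hasFDerivAt
    exact ((EuclideanSpace.proj i : EuclideanSpace ℝ (Fin (n+1)) →L[ℝ] ℝ).hasFDerivAt).comp x
      (h2.comp x h1)
  · exact hcont.continuousOn.integrableOn_compact isCompact_Icc

lemma aux_bdd {d : ℕ} {z : EuclideanSpace ℝ (Fin d) → EuclideanSpace ℝ (Fin d)}
    (hz : Continuous z) (hp : ZdPeriodic z) : BddAbove (Set.range fun x => ‖z x‖) := by
  obtain ⟨C, hC⟩ := (aux_K_compact d).bddAbove_image (f := fun x => ‖z x‖) hz.norm.continuousOn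
  refine ⟨C, ?_⟩
  rintro _ ⟨x, rfl⟩
  have h := hp x (fun i => -⌊x i⌋)
  simp only
  rw [← h]
  refine hC ⟨_, aux_cube_sub d ?_, rfl⟩
  intro i
  have h1 := Int.floor_le (x i)
  have h2 := Int.lt_floor_add_one (x i)
  constructor <;> simp <;> linarith

lemma aux_diverg_per {d : ℕ} {z : EuclideanSpace ℝ (Fin d) → EuclideanSpace ℝ (Fin d)}
    (hp : ZdPeriodic z) : ZdPeriodic (diverg z) := by
  intro x m
  unfold diverg
  set v := (EuclideanSpace.equiv (Fin d) ℝ).symm (fun i => (m i : ℝ))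
  have : fderiv ℝ z (x + v) = fderiv ℝ z x := by
    rw [← fderiv_comp_add_right]
    congr 1
    ext1 y
    exact hp y m
  rw [this]

lemma aux_diverg_C1 {d : ℕ} {z : EuclideanSpace ℝ (Fin d) → EuclideanSpace ℝ (Fin d)}
    (hz : ContDiff ℝ 2 z) : ContDiff ℝ 1 (diverg z) := by
  have h : ContDiff ℝ 1 (fderiv ℝ z) := hz.fderiv_right (by norm_num)
  unfold diverg
  refine ContDiff.sum fun i _ => ?_
  exact (EuclideanSpace.proj i : EuclideanSpace ℝ (Fin d) →L[ℝ] ℝ).contDiff.comp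
    (h.clm_apply contDiff_const)

lemma aux_diverg_smul {d : ℕ} {z : EuclideanSpace ℝ (Fin d) → EuclideanSpace ℝ (Fin d)}
    {f : EuclideanSpace ℝ (Fin d) → ℝ} {x : EuclideanSpace ℝ (Fin d)}
    (hz : DifferentiableAt ℝ z x) (hf : DifferentiableAt ℝ f x) :
    diverg (fun y => f y • z y) x = f x * diverg z x + fderiv ℝ f x (z x) := by
  unfold diverg
  rw [fderiv_fun_smul hf hz]
  have : fderiv ℝ f x (z x) = ∑ i, z x i * fderiv ℝ f x (EuclideanSpace.single i 1) := by
    conv_lhs => rw [← (EuclideanSpace.basisFun (Fin d) ℝ).sum_repr (z x)]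
    simp [map_sum]
  rw [this, Finset.mul_sum, ← Finset.sum_add_distrib]
  refine Finset.sum_congr rfl fun i _ => ?_
  simp
  ring

/-- Gagliardo–Nirenberg type inequality, Appendix B:
for a `C²` periodic vector field `z` on the torus,
`∫ (div z)⁴ ≤ 9 (sup |z|)² ∫ |∇(div z)|²`. -/
theorem gagliardo_nirenberg_div (d : ℕ) (hd : 1 ≤ d)
    (z : EuclideanSpace ℝ (Fin d) → EuclideanSpace ℝ (Fin d))
    (hz : ContDiff ℝ 2 z) (hzper : ZdPeriodic z) :
    ∫ x in UnitCube d, (diverg z x) ^ 4 ≤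
      9 * (⨆ x, ‖z x‖) ^ 2 * ∫ x in UnitCube d, ‖gradient (diverg z) x‖ ^ 2 := by
  have hu := aux_diverg_C1 hz
  have hup := aux_diverg_per hzper
  have hz1 : ContDiff ℝ 1 z := hz.of_le (by norm_num)
  set u := diverg z with hudef
  set M := ⨆ x, ‖z x‖ with hM
  have hb := aux_bdd hz.continuous hzper
  have hzM : ∀ x, ‖z x‖ ≤ M := fun x => le_ciSup hb x
  have hud : Differentiable ℝ u := hu.differentiable (by norm_num)
  have hzd : Differentiable ℝ z := hz1.differentiable (by norm_num)
  have hgc : Continuous (gradient u) :=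
    (InnerProductSpace.toDual ℝ (EuclideanSpace ℝ (Fin d))).symm.continuous.comp
      (hu.continuous_fderiv (by norm_num))
  have hgz : ∀ x, fderiv ℝ u x (z x) = inner ℝ (gradient u x) (z x) := by
    intro x
    simp [gradient]
  have hF : ContDiff ℝ 1 (fun x => (u x)^3 • z x) := (hu.pow 3).smul hz1
  have hFp : ZdPeriodic (fun x => (u x)^3 • z x) := by
    intro x m
    simp only [hup x m, hzper x m]
  have h0 := aux_div_zero hd hF hFp
  have hdiv : ∀ x, diverg (fun x => (u x)^3 • z x) x
      = u x ^ 4 + 3 * u x ^ 2 * inner ℝ (gradient u x) (z x) := by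
    intro x
    rw [aux_diverg_smul (f := fun y => u y ^ 3) (hzd x) ((hud x).fun_pow 3), fderiv_fun_pow 3 (hud x), ← hgz, ← hudef]
    simp
    ring
  simp_rw [hdiv] at h0
  have huc := hu.continuous
  have hzc := hz.continuous
  have hle : ∫ x in UnitCube d, (u x ^ 4 - 9 * M ^ 2 * ‖gradient u x‖ ^ 2) ≤
      ∫ x in UnitCube d, 2 * (u x ^ 4 + 3 * u x ^ 2 * inner ℝ (gradient u x) (z x)) := by
    refine integral_mono (aux_integrable (by fun_prop)) (aux_integrable (by fun_prop)) ?_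
    intro x
    have h1 := neg_le_of_abs_le ((abs_real_inner_le_norm (gradient u x) (z x)).trans
      (mul_le_mul_of_nonneg_left (hzM x) (norm_nonneg _)))
    have h2 := mul_le_mul_of_nonneg_left h1 (sq_nonneg (u x))
    simp only
    nlinarith [sq_nonneg (u x ^ 2 - 3 * M * ‖gradient u x‖)]
  rw [integral_const_mul, h0, integral_sub (aux_integrable (by fun_prop))
    (aux_integrable (by fun_prop)), integral_const_mul] at hle
  linarith

end
end

section
/- Let q > 1, 0 < γ < q − 1 and M > 0, and set q′ = q/(q−1). Then there exists a constant C′ > 0, depending only on M, γ and q, with the following property: for every metric space (X, d), every T > 0 and every map ω : (0,T] → X satisfying d(ω(s), ω(s′)) ≤ M |s′ − s|^{1/q′} s^{−γ/q} for all 0 < s ≤ s′ ≤ T, one has d(ω(s), ω(s′)) ≤ C′ |s′ − s|^{1 − (γ+1)/q} for all 0 < s ≤ s′ ≤ T. -/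
universe u

/-- dyadic core of Lemma B.2: a Hölder-type bound
`d(ω(s), ω(s')) ≤ M |s'-s|^{1/q'} s^{-γ/q}` (with `q' = q/(q-1)`) that degenerates as
`s → 0` upgrades to a uniform Hölder bound with exponent `1 - (γ+1)/q`, with a constant
depending only on `M`, `γ`, `q`. -/
theorem holder_upgrade_dyadic (q γ M : ℝ) (hq : 1 < q) (hγ0 : 0 < γ)
    (hγ : γ < q - 1) (hM : 0 < M) :
    ∃ C' : ℝ, 0 < C' ∧
      ∀ (X : Type u) [MetricSpace X] (T : ℝ), 0 < T →
        ∀ ω : ℝ → X,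
          (∀ s s' : ℝ, 0 < s → s ≤ s' → s' ≤ T →
            dist (ω s) (ω s') ≤ M * (s' - s) ^ (1 / (q / (q - 1))) * s ^ (-(γ / q))) →
          ∀ s s' : ℝ, 0 < s → s ≤ s' → s' ≤ T →
            dist (ω s) (ω s') ≤ C' * (s' - s) ^ (1 - (γ + 1) / q) := by
  have hq0 : (0:ℝ) < q := by linarith
  have hα : 1 / (q / (q - 1)) = (1 - (γ + 1) / q) + γ / q := by
    have : q - 1 ≠ 0 := by linarith
    field_simp
    ring
  have hδ : 0 < 1 - (γ + 1) / q := by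
    have : (γ + 1) / q < 1 := by rw [div_lt_one hq0]; linarith
    linarith
  have hβ : 0 < γ / q := by positivity
  rw [hα]
  generalize 1 - (γ + 1) / q = δ at *
  generalize γ / q = β at *
  clear hα
  have hr0 : (0:ℝ) < (1/2:ℝ) ^ δ := by positivity
  have hr1 : (1/2:ℝ) ^ δ < 1 := Real.rpow_lt_one (by norm_num) (by norm_num) hδ
  have hhalf : ∀ h : ℝ, 0 < h → (h / 2) ^ δ = h ^ δ * (1/2:ℝ) ^ δ := by
    intro h hh
    rw [← Real.mul_rpow hh.le (by norm_num)]
    congr 1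
    ring
  generalize (1/2:ℝ) ^ δ = r at *
  have h1r : 0 < 1 - r := by linarith
  refine ⟨M / (1 - r), by positivity, ?_⟩
  intro X _ T hT ω hω
  have hCM : M ≤ M / (1 - r) := by
    rw [le_div_iff₀ h1r]; nlinarith
  have hCr : M / (1 - r) * r + M = M / (1 - r) := by
    field_simp
    ring
  generalize M / (1 - r) = C at *
  have base : ∀ s s' : ℝ, 0 < s → s < s' → s' ≤ T → s' - s ≤ s →
      dist (ω s) (ω s') ≤ M * (s' - s) ^ δ := by
    intro s s' hs hss hsT hle
    have hp : 0 < s' - s := by linarith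
    refine (hω s s' hs hss.le hsT).trans ?_
    have h1 : s ^ (-β) ≤ (s' - s) ^ (-β) :=
      Real.rpow_le_rpow_of_nonpos hp hle (by linarith)
    calc M * (s' - s) ^ (δ + β) * s ^ (-β)
        ≤ M * (s' - s) ^ (δ + β) * (s' - s) ^ (-β) := by gcongr
      _ = M * (s' - s) ^ δ := by
        rw [mul_assoc, ← Real.rpow_add hp]
        congr 2
        ring
  have key : ∀ n : ℕ, ∀ s s' : ℝ, 0 < s → s < s' → s' ≤ T → s' - s ≤ 2 ^ n * s →
      dist (ω s) (ω s') ≤ C * (s' - s) ^ δ := by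
    intro n
    induction n with
    | zero =>
      intro s s' hs hss hsT hle
      have hp : 0 < s' - s := by linarith
      refine (base s s' hs hss hsT (by simpa using hle)).trans ?_
      gcongr
    | succ n ih =>
      intro s s' hs hss hsT hle
      have hp : 0 < s' - s := by linarith
      have a1 := ih s (s + (s' - s) / 2) hs (by linarith) (by linarith)
        (by rw [pow_succ] at hle; linarith)
      have a2 := base (s + (s' - s) / 2) s' (by linarith) (by linarith) hsT (by linarith)
      rw [show s + (s' - s) / 2 - s = (s' - s) / 2 by ring, hhalf _ hp] at a1
      rw [show s' - (s + (s' - s) / 2) = (s' - s) / 2 by ring, hhalf _ hp] at a2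
      have hpos : 0 < (s' - s) ^ δ := by positivity
      have a3 := dist_triangle (ω s) (ω (s + (s' - s) / 2)) (ω s')
      have a4 : M * ((s' - s) ^ δ * r) ≤ M * (s' - s) ^ δ := by
        gcongr
        nlinarith
      calc dist (ω s) (ω s') ≤ C * ((s' - s) ^ δ * r) + M * (s' - s) ^ δ := by linarith
        _ = (C * r + M) * (s' - s) ^ δ := by ring
        _ = C * (s' - s) ^ δ := by rw [hCr]
  intro s s' hs hss hsT
  rcases hss.eq_or_lt with h | h
  · subst h
    simp [Real.zero_rpow hδ.ne']
  · obtain ⟨n, hn⟩ := pow_unbounded_of_one_lt ((s' - s) / s) (one_lt_two : (1:ℝ) < 2)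
    rw [div_lt_iff₀ hs] at hn
    exact key n s s' hs h hsT hn.le
end

section
/- Let T > 0, c > 0 and q > 1, and let φ : (0,T] → [0,∞) be measurable and satisfy φ(s) ≥ φ(t) + c ∫_s^t φ(r)^q dr for all 0 < s ≤ t ≤ T. Then φ(t) ≤ (c (q − 1) t)^{−1/(q−1)} for every t ∈ (0,T]. -/
open MeasureTheory

lemma aux_tangent (q a b : ℝ) (hq : 1 < q) (ha : 0 < a) (hb : 0 < b) :
    (q - 1) * a ^ (-q) * (a - b) ≤ b ^ (1 - q) - a ^ (1 - q) := by
  have hu : 0 < b / a := div_pos hb ha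
  have h1 : 1 + (q - 1) * (1 - b / a) ≤ (b / a) ^ (1 - q) := by
    rw [Real.rpow_def_of_pos hu]
    have h2 := Real.add_one_le_exp (Real.log (b / a) * (1 - q))
    have h3 := Real.log_le_sub_one_of_pos hu
    nlinarith
  rw [Real.div_rpow hb.le ha.le] at h1
  have hA : 0 < a ^ (1 - q) := Real.rpow_pos_of_pos ha _
  rw [le_div_iff₀ hA] at h1
  have h4 : a ^ (1 - q) = a * a ^ (-q) := by
    rw [sub_eq_add_neg, Real.rpow_add ha, Real.rpow_one]
  have h5 : (1 + (q - 1) * (1 - b / a)) * a ^ (1 - q)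
      = a ^ (1 - q) + (q - 1) * a ^ (-q) * (a - b) := by
    rw [h4]; field_simp
  linarith

/-- ODE comparison, Section 5: a measurable nonnegative function
`φ : (0,T] → [0,∞)` satisfying the integral inequality
`φ(s) ≥ φ(t) + c ∫_s^t φ(r)^q dr` for all `0 < s ≤ t ≤ T` obeys the universal decay
bound `φ(t) ≤ (c(q-1)t)^{-1/(q-1)}`. -/
theorem decay_from_integral_inequality (T c q : ℝ) (hT : 0 < T) (hc : 0 < c)
    (hq : 1 < q) (φ : ℝ → ℝ) (hmeas : Measurable φ)
    (hnonneg : ∀ t ∈ Set.Ioc 0 T, 0 ≤ φ t)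
    (hineq : ∀ s t : ℝ, 0 < s → s ≤ t → t ≤ T →
      φ t + c * ∫ r in s..t, (φ r) ^ q ≤ φ s) :
    ∀ t ∈ Set.Ioc 0 T, φ t ≤ (c * (q - 1) * t) ^ (-(1 / (q - 1))) := by
  rintro t ⟨ht0, htT⟩
  have hq1 : 0 < q - 1 := by linarith
  have hK : 0 < c * (q - 1) := mul_pos hc hq1
  rcases (hnonneg t ⟨ht0, htT⟩).eq_or_lt with hm | hm
  · rw [← hm]; positivity
  have hanti : ∀ s u : ℝ, 0 < s → s ≤ u → u ≤ T → φ u ≤ φ s := by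
    intro s u hs hsu huT
    have h1 := hineq s u hs hsu huT
    have h2 : 0 ≤ ∫ r in s..u, (φ r) ^ q := by
      apply intervalIntegral.integral_nonneg hsu
      intro r hr
      exact Real.rpow_nonneg (hnonneg r ⟨by linarith [hr.1], by linarith [hr.2]⟩) _
    have := mul_nonneg hc.le h2
    linarith
  have hint : ∀ s u : ℝ, 0 < s → s ≤ u → u ≤ T →
      IntervalIntegrable (fun r => φ r ^ q) volume s u := by
    intro s u hs hsu huT
    apply AntitoneOn.intervalIntegrable
    rw [Set.uIcc_of_le hsu]
    intro x hx y hy hxy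
    exact Real.rpow_le_rpow (hnonneg y ⟨by linarith [hy.1], by linarith [hy.2]⟩)
      (hanti x y (by linarith [hx.1]) hxy (by linarith [hy.2])) (by linarith)
  have key : ∀ s : ℝ, 0 < s → s ≤ t → c * (q - 1) * (t - s) ≤ φ t ^ (1 - q) := by
    intro s hs hst
    set ψ : ℝ → ℝ := fun x => φ t + c * ((∫ r in s..t, φ r ^ q) - ∫ r in s..x, φ r ^ q) with hψ
    have hψt : ψ t = φ t := by simp [hψ]
    have hdiff : ∀ x z, s ≤ x → x ≤ z → z ≤ t →
        ψ x - ψ z = c * ∫ r in x..z, φ r ^ q := by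
      intro x z hx hxz hz
      have := intervalIntegral.integral_add_adjacent_intervals
        (hint s x hs hx (by linarith)) (hint x z (by linarith) hxz (by linarith))
      simp only [hψ]; rw [← this]; ring
    have hle : ∀ x, s ≤ x → x ≤ t → ψ x ≤ φ x := by
      intro x hx hxt
      have h1 := hdiff x t hx hxt le_rfl
      have h2 := hineq x t (by linarith) hxt htT
      linarith
    have hge : ∀ x, s ≤ x → x ≤ t → φ t ≤ ψ x := by
      intro x hx hxt
      have h1 := hdiff x t hx hxt le_rfl
      have h2 : 0 ≤ ∫ r in x..t, (φ r) ^ q := by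
        apply intervalIntegral.integral_nonneg hxt
        intro r hr
        exact Real.rpow_nonneg (hnonneg r ⟨by linarith [hr.1], by linarith [hr.2]⟩) _
      have := mul_nonneg hc.le h2
      linarith
    have hstep : ∀ x z, s ≤ x → x ≤ z → z ≤ t → c * ((z - x) * ψ z ^ q) ≤ ψ x - ψ z := by
      intro x z hx hxz hz
      rw [hdiff x z hx hxz hz]
      apply mul_le_mul_of_nonneg_left _ hc.le
      have h1 : ∫ r in x..z, ψ z ^ q = (z - x) * ψ z ^ q := by simp
      rw [← h1]
      apply intervalIntegral.integral_mono_on hxz (by simp) (hint x z (by linarith) hxz (by linarith))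
      intro r hr
      apply Real.rpow_le_rpow (hm.le.trans (hge z (by linarith) hz)) _ (by linarith)
      exact (hle z (by linarith) hz).trans (hanti r z (by linarith [hr.1]) hr.2 (by linarith))
    have hcont : ContinuousOn ψ (Set.Icc s t) := by
      have h1 : ContinuousOn (fun x => ∫ r in s..x, φ r ^ q) (Set.uIcc s t) := by
        apply intervalIntegral.continuousOn_primitive_interval
        rw [← intervalIntegrable_iff']
        exact hint s t hs hst htT
      rw [Set.uIcc_of_le hst] at h1
      fun_prop
    have hpos : ∀ x ∈ Set.Icc s t, 0 < ψ x := fun x hx => hm.trans_le (hge x hx.1 hx.2)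
    have hfin := image_le_of_liminf_slope_right_le_deriv_boundary
      (f := fun x => - ψ x ^ (1 - q)) (a := s) (b := t)
      (B := fun x => - ψ s ^ (1 - q) - c * (q - 1) * (x - s)) (B' := fun _ => - (c * (q - 1)))
      (hcont.rpow_const (fun x hx => Or.inl (hpos x hx).ne')).neg (by simp)
      (by fun_prop)
      (by
        intro x hx
        have := (((hasDerivAt_id x).sub_const s).const_mul (c * (q - 1))).const_sub
          (- ψ s ^ (1 - q))
        simpa using this.hasDerivWithinAt)
      (by
        intro x hx r hr
        apply Filter.Eventually.frequently
        have hxI : x ∈ Set.Icc s t := ⟨hx.1, hx.2.le⟩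
        have hx0 := hpos x hxI
        have hmem : Set.Icc s t ∈ nhdsWithin x (Set.Ioi x) :=
          Filter.mem_of_superset (Ioc_mem_nhdsGT hx.2) (fun z hz => ⟨hx.1.trans hz.1.le, hz.2⟩)
        have htend : Filter.Tendsto ψ (nhdsWithin x (Set.Ioi x)) (nhds (ψ x)) :=
          (hcont x hxI).mono_left (nhdsWithin_le_of_mem hmem)
        have ht2 : Filter.Tendsto (fun z => -(c * (q - 1) * (ψ x ^ (-q) * ψ z ^ q)))
            (nhdsWithin x (Set.Ioi x)) (nhds (-(c * (q - 1) * (ψ x ^ (-q) * ψ x ^ q)))) :=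
          (((htend.rpow_const (Or.inl hx0.ne')).const_mul _).const_mul _).neg
        have he : ψ x ^ (-q) * ψ x ^ q = 1 := by
          rw [← Real.rpow_add hx0]; simp
        rw [he, mul_one] at ht2
        filter_upwards [ht2.eventually (gt_mem_nhds hr), hmem, self_mem_nhdsWithin] with z hz hzI hxz
        refine lt_of_le_of_lt ?_ hz
        have hxz' : x < z := hxz
        rw [slope_def_field, div_le_iff₀ (by linarith)]
        have h1 := aux_tangent q (ψ x) (ψ z) hq hx0 (hpos z hzI)
        have h2 := hstep x z hx.1 hxz'.le hzI.2
        have h3 : 0 ≤ (q - 1) * ψ x ^ (-q) := by positivity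
        have h4 := mul_le_mul_of_nonneg_left h2 h3
        linarith)
      (Set.right_mem_Icc.2 hst)
    simp only [hψt] at hfin
    have := Real.rpow_nonneg (hpos s ⟨le_rfl, hst⟩).le (1 - q)
    linarith
  have hlim : c * (q - 1) * t ≤ φ t ^ (1 - q) := by
    apply le_of_forall_pos_le_add
    intro ε hε
    have h1 := key (min t (ε / (c * (q - 1)))) (lt_min ht0 (by positivity)) (min_le_left _ _)
    have h2 : c * (q - 1) * min t (ε / (c * (q - 1))) ≤ ε := by
      calc _ ≤ c * (q - 1) * (ε / (c * (q - 1))) :=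
            mul_le_mul_of_nonneg_left (min_le_right _ _) hK.le
        _ = ε := by field_simp
    linarith
  have h5 := Real.rpow_le_rpow_of_nonpos (z := -(1 / (q - 1))) (mul_pos hK ht0) hlim
    (by have : 0 < 1 / (q - 1) := by positivity
        linarith)
  rw [← Real.rpow_mul hm.le] at h5
  have h6 : (1 - q) * -(1 / (q - 1)) = 1 := by field_simp; ring
  rwa [h6, Real.rpow_one] at h5
end

section
/- Let d ≥ 1, let u : ℝᵈ → ℝ be C¹ and ℤᵈ-periodic, let z : ℝᵈ → ℝᵈ be a C¹ ℤᵈ-periodic vector field such that |z(x)| ≤ 1 for every x and ∫ |∇u| ≤ ∫ z · ∇u, and let g : ℝ → ℝ be a C¹ function with g′ ≥ 0 everywhere. Then ∫ |∇(g ∘ u)| ≤ ∫ z · ∇(g ∘ u); that is, the pair (g(u), z) again satisfies the same compatibility condition. -/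
open MeasureTheory
open scoped RealInnerProductSpace

noncomputable section

/-- contrast-change invariance, Lemma 2.2 in the smooth setting: if
`|z| ≤ 1`, `∫ |∇u| ≤ ∫ z · ∇u` and `g : ℝ → ℝ` is `C¹` with `g' ≥ 0`, then the pair
`(g ∘ u, z)` satisfies the same compatibility condition:
`∫ |∇(g∘u)| ≤ ∫ z · ∇(g∘u)`. -/
theorem contrast_change_invariance (d : ℕ) (hd : 1 ≤ d)
    (u : EuclideanSpace ℝ (Fin d) → ℝ)
    (z : EuclideanSpace ℝ (Fin d) → EuclideanSpace ℝ (Fin d))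
    (hu : ContDiff ℝ 1 u) (hz : ContDiff ℝ 1 z)
    (huper : ZdPeriodic u) (hzper : ZdPeriodic z)
    (hz1 : ∀ x, ‖z x‖ ≤ 1)
    (hcomp : ∫ x in UnitCube d, ‖gradient u x‖ ≤
      ∫ x in UnitCube d, ⟪z x, gradient u x⟫)
    (g : ℝ → ℝ) (hg : ContDiff ℝ 1 g) (hg' : ∀ s, 0 ≤ deriv g s) :
    ∫ x in UnitCube d, ‖gradient (fun y => g (u y)) x‖ ≤
      ∫ x in UnitCube d, ⟪z x, gradient (fun y => g (u y)) x⟫ := by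
  have hud : Differentiable ℝ u := hu.differentiable one_ne_zero
  have hgd : Differentiable ℝ g := hg.differentiable one_ne_zero
  have hgrad : Continuous (fun x => gradient u x) := by
    unfold gradient
    exact (InnerProductSpace.toDual ℝ (EuclideanSpace ℝ (Fin d))).symm.continuous.comp
      (hu.continuous_fderiv one_ne_zero)
  have hchain : ∀ x, gradient (fun y => g (u y)) x = deriv g (u x) • gradient u x := by
    intro x
    have h1 : HasFDerivAt (fun y => g (u y)) (deriv g (u x) • fderiv ℝ u x) x :=
      (hgd (u x)).hasDerivAt.comp_hasFDerivAt x (hud x).hasFDerivAt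
    unfold gradient
    rw [h1.fderiv]
    simp
  have hsub : UnitCube d ⊆
      (EuclideanSpace.equiv (Fin d) ℝ) ⁻¹' (Set.Icc (0 : Fin d → ℝ) 1) := by
    intro x hx
    exact ⟨fun i => (hx i).1, fun i => (hx i).2.le⟩
  have hK : IsCompact ((EuclideanSpace.equiv (Fin d) ℝ) ⁻¹' (Set.Icc (0 : Fin d → ℝ) 1)) :=
    (EuclideanSpace.equiv (Fin d) ℝ).toHomeomorph.isCompact_preimage.2 isCompact_Icc
  have hint : ∀ f : EuclideanSpace ℝ (Fin d) → ℝ, Continuous f →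
      IntegrableOn f (UnitCube d) volume := fun f hf =>
    (hf.continuousOn.integrableOn_compact hK).mono_set hsub
  have hi1 := hint _ hgrad.norm
  have hi2 := hint _ (hz.continuous.inner (𝕜 := ℝ) hgrad)
  have hle : ∀ x, ⟪z x, gradient u x⟫ ≤ ‖gradient u x‖ := fun x =>
    (real_inner_le_norm _ _).trans (mul_le_of_le_one_left (norm_nonneg _) (hz1 x))
  have h0 : ∫ x in UnitCube d, (‖gradient u x‖ - ⟪z x, gradient u x⟫) = 0 := by
    apply le_antisymm
    · rw [integral_sub hi1 hi2]
      linarith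
    · exact integral_nonneg fun x => sub_nonneg.2 (hle x)
  rw [integral_eq_zero_iff_of_nonneg (fun x => sub_nonneg.2 (hle x)) (hi1.sub hi2)] at h0
  refine le_of_eq (integral_congr_ae ?_)
  filter_upwards [h0] with x hx
  have hx' : ‖gradient u x‖ = ⟪z x, gradient u x⟫ := sub_eq_zero.1 hx
  rw [hchain, norm_smul, inner_smul_right, Real.norm_of_nonneg (hg' _), hx']

end
end

section
/- Let d ≥ 1, let u, g : ℝᵈ → ℝ be C¹ and ℤᵈ-periodic, and let z : ℝᵈ → ℝᵈ be a C² ℤᵈ-periodic vector field such that |z(x)| ≤ 1 for every x, ∫ |∇u| ≤ ∫ z · ∇u, and −div z + u = g everywhere on ℝᵈ. Then ∫ |∇u|² ≤ ∫ |∇g|². -/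
open MeasureTheory
open scoped RealInnerProductSpace

noncomputable section

open Filter Topology

theorem unitCube_eq (d : ℕ) :
    UnitCube d = ZSpan.fundamentalDomain (EuclideanSpace.basisFun (Fin d) ℝ).toBasis := by
  ext x
  simp [UnitCube, ZSpan.mem_fundamentalDomain]

theorem unitCube_meas (d : ℕ) : MeasurableSet (UnitCube d) := by
  rw [unitCube_eq]; exact ZSpan.fundamentalDomain_measurableSet _

theorem unitCube_bdd (d : ℕ) : Bornology.IsBounded (UnitCube d) := by
  rw [unitCube_eq]; exact ZSpan.fundamentalDomain_isBounded _

theorem cube_integrable {d : ℕ} {f : EuclideanSpace ℝ (Fin d) → ℝ} (hf : Continuous f) :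
    Integrable f (volume.restrict (UnitCube d)) := by
  have h1 : IsCompact (closure (UnitCube d)) := (unitCube_bdd d).isCompact_closure
  exact (hf.continuousOn.integrableOn_compact h1).mono_set subset_closure

theorem cube_translate {d : ℕ} {f : EuclideanSpace ℝ (Fin d) → ℝ} (hf : ZdPeriodic f)
    (h : EuclideanSpace ℝ (Fin d)) :
    ∫ x in UnitCube d, f (x + h) = ∫ x in UnitCube d, f x := by
  have hF := ZSpan.isAddFundamentalDomain (EuclideanSpace.basisFun (Fin d) ℝ).toBasis
    (volume : Measure (EuclideanSpace ℝ (Fin d)))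
  have hF2 := hF.vadd_of_comm h
  have hinv : ∀ (l : Submodule.span ℤ (Set.range (EuclideanSpace.basisFun (Fin d) ℝ).toBasis))
      (x : EuclideanSpace ℝ (Fin d)), f (l +ᵥ x) = f x := by
    rintro ⟨l, hl⟩ x
    rw [Module.Basis.mem_span_iff_repr_mem] at hl
    choose m hm using hl
    have : l = (EuclideanSpace.equiv (Fin d) ℝ).symm (fun i => (m i : ℝ)) := by
      ext i
      have := hm i
      simp at this
      simp [this]
    rw [Submodule.vadd_def, vadd_eq_add, add_comm]
    simp only
    rw [this]
    exact hf x m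
  have : Countable (Submodule.span ℤ (Set.range (EuclideanSpace.basisFun (Fin d) ℝ).toBasis)) :=
    inferInstance
  have : VAddInvariantMeasure
      (Submodule.span ℤ (Set.range (EuclideanSpace.basisFun (Fin d) ℝ).toBasis))
      (EuclideanSpace ℝ (Fin d)) volume :=
    inferInstanceAs (VAddInvariantMeasure
      (Submodule.span ℤ (Set.range (EuclideanSpace.basisFun (Fin d) ℝ).toBasis)).toAddSubgroup
      (EuclideanSpace ℝ (Fin d)) volume)
  have := hF.setIntegral_eq hF2 (f := f) hinv
  rw [unitCube_eq, this]
  have h3 := (measurePreserving_add_left (volume : Measure (EuclideanSpace ℝ (Fin d))) h).setIntegral_image_emb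
    (measurableEmbedding_addLeft h) f (ZSpan.fundamentalDomain (EuclideanSpace.basisFun (Fin d) ℝ).toBasis)
  simp only [add_comm _ h]
  rw [← h3]
  rfl

theorem cube_slope {d : ℕ} {f : EuclideanSpace ℝ (Fin d) → ℝ} (hf : ContDiff ℝ 1 f)
    (e : EuclideanSpace ℝ (Fin d)) {φ : ℝ → ℝ} (hφ : Continuous φ) :
    Tendsto (fun t : ℝ => ∫ x in UnitCube d, φ (t⁻¹ * (f (x + t • e) - f x))) (𝓝[≠] 0)
      (𝓝 (∫ x in UnitCube d, φ (fderiv ℝ f x e))) := by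
  obtain ⟨R, hR⟩ := (unitCube_bdd d).subset_closedBall 0
  have hcf : Continuous (fderiv ℝ f) := hf.continuous_fderiv (by norm_num)
  have hfc := hf.continuous
  obtain ⟨C, hC⟩ := (isCompact_closedBall (0 : EuclideanSpace ℝ (Fin d)) (R + ‖e‖)).exists_bound_of_continuousOn
    hcf.continuousOn
  obtain ⟨M, hM⟩ := (isCompact_closedBall (0 : ℝ) (C * ‖e‖)).exists_bound_of_continuousOn hφ.continuousOn
  refine tendsto_integral_filter_of_dominated_convergence (fun _ => M) ?_ ?_ ?_ ?_
  · refine Eventually.of_forall fun t => Continuous.aestronglyMeasurable ?_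
    fun_prop
  · have h1 : ∀ᶠ t : ℝ in 𝓝[≠] 0, |t| < 1 := by
      apply eventually_nhdsWithin_of_eventually_nhds
      filter_upwards [Metric.ball_mem_nhds (0 : ℝ) one_pos] with t ht
      simpa using ht
    filter_upwards [h1, self_mem_nhdsWithin] with t ht ht0
    filter_upwards [ae_restrict_mem (unitCube_meas d)] with x hx
    apply hM
    have hx' : ‖x‖ ≤ R := by simpa using hR hx
    have hte : ‖t • e‖ ≤ ‖e‖ := by
      rw [norm_smul, Real.norm_eq_abs]
      nlinarith [norm_nonneg e]
    have hb := Convex.norm_image_sub_le_of_norm_fderiv_le (𝕜 := ℝ) (f := f) (C := C)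
      (s := Metric.closedBall 0 (R + ‖e‖)) (x := x) (y := x + t • e)
      (fun y _ => (hf.differentiable (by norm_num)) y) hC (convex_closedBall _ _)
      (by simp; linarith [norm_nonneg e]) (by simp; linarith [norm_add_le x (t • e)])
    have ht0' : 0 < |t| := abs_pos.mpr ht0
    simp only [mem_closedBall_zero_iff, norm_mul, norm_inv, Real.norm_eq_abs]
    rw [inv_mul_le_iff₀ ht0']
    simp only [add_sub_cancel_left, norm_smul, Real.norm_eq_abs] at hb
    linarith
  · exact cube_integrable continuous_const
  · refine Eventually.of_forall fun x => ?_
    have h1 : HasLineDerivAt ℝ f (fderiv ℝ f x e) x e :=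
      ((hf.differentiable (by norm_num)) x).hasFDerivAt.hasLineDerivAt e
    have := h1.tendsto_slope_zero
    simp only [smul_eq_mul] at this
    exact (hφ.tendsto _).comp this

theorem cube_fderiv_zero {d : ℕ} {f : EuclideanSpace ℝ (Fin d) → ℝ} (hf : ContDiff ℝ 1 f)
    (hp : ZdPeriodic f) (e : EuclideanSpace ℝ (Fin d)) :
    ∫ x in UnitCube d, fderiv ℝ f x e = 0 := by
  have h := cube_slope hf e continuous_id
  have h0 : ∀ t : ℝ, ∫ x in UnitCube d, id (t⁻¹ * (f (x + t • e) - f x)) = 0 := by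
    intro t
    have hfc := hf.continuous
    simp only [id]
    rw [integral_const_mul, integral_sub (cube_integrable (by fun_prop)) (cube_integrable hfc),
      cube_translate hp, sub_self, mul_zero]
  simp only [h0] at h
  exact (tendsto_nhds_unique h tendsto_const_nhds)

theorem gradient_cont {d : ℕ} {v : EuclideanSpace ℝ (Fin d) → ℝ} (hv : ContDiff ℝ 1 v) :
    Continuous (gradient v) := by
  have hcf : Continuous (fderiv ℝ v) := hv.continuous_fderiv (by norm_num)
  unfold gradient
  fun_prop

theorem cube_ibp {d : ℕ} {v : EuclideanSpace ℝ (Fin d) → ℝ}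
    {w : EuclideanSpace ℝ (Fin d) → EuclideanSpace ℝ (Fin d)}
    (hv : ContDiff ℝ 1 v) (hw : ContDiff ℝ 1 w) (hvp : ZdPeriodic v) (hwp : ZdPeriodic w) :
    ∫ x in UnitCube d, (diverg w x * v x + ⟪w x, gradient v x⟫) = 0 := by
  have hwi : ∀ i, ContDiff ℝ 1 (fun x => w x i) := fun i => by fun_prop
  have hF : ∀ i, ContDiff ℝ 1 (fun x => w x i * v x) := fun i => (hwi i).mul hv
  have key : ∀ x, diverg w x * v x + ⟪w x, gradient v x⟫
      = ∑ i, fderiv ℝ (fun x => w x i * v x) x (EuclideanSpace.single i 1) := by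
    intro x
    have hwx : DifferentiableAt ℝ w x := (hw.differentiable (by norm_num)) x
    have hvx : DifferentiableAt ℝ v x := (hv.differentiable (by norm_num)) x
    have h1 : ∀ i, fderiv ℝ (fun x => w x i * v x) x (EuclideanSpace.single i 1)
        = fderiv ℝ w x (EuclideanSpace.single i 1) i * v x
          + w x i * fderiv ℝ v x (EuclideanSpace.single i 1) := by
      intro i
      have h2 : HasFDerivAt (fun x => w x i)
          ((EuclideanSpace.proj i : EuclideanSpace ℝ (Fin d) →L[ℝ] ℝ).comp (fderiv ℝ w x)) x :=
        (EuclideanSpace.proj i : EuclideanSpace ℝ (Fin d) →L[ℝ] ℝ).hasFDerivAt.comp x hwx.hasFDerivAt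
      have h3 : fderiv ℝ (fun x => w x i * v x) x = _ := (h2.mul hvx.hasFDerivAt).fderiv
      rw [h3]
      simp
      ring
    simp only [h1, Finset.sum_add_distrib, ← Finset.sum_mul, diverg]
    congr 1
    rw [PiLp.inner_apply]
    refine Finset.sum_congr rfl fun i _ => ?_
    have : gradient v x i = ⟪gradient v x, EuclideanSpace.single i 1⟫ := by
      simp [EuclideanSpace.inner_single_right, -inner_gradient_left]
    rw [this, inner_gradient_left]
    simp [mul_comm]
  simp only [key]
  rw [integral_finsetSum]
  · refine Finset.sum_eq_zero fun i _ => cube_fderiv_zero (hF i) ?_ _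
    intro x m
    simp only [hvp x m, hwp x m]
  · intro i _
    apply cube_integrable
    have := (hF i).continuous_fderiv (by norm_num)
    fun_prop

theorem periodic_fderiv {d : ℕ} {V : Type*} [NormedAddCommGroup V] [NormedSpace ℝ V]
    {f : EuclideanSpace ℝ (Fin d) → V} (hf : ZdPeriodic f) : ZdPeriodic (fderiv ℝ f) := by
  intro x m
  rw [← fderiv_comp_add_right]
  congr 1
  funext y
  exact hf y m

theorem periodic_shift {d : ℕ} {V : Type*} 
    {f : EuclideanSpace ℝ (Fin d) → V} (hf : ZdPeriodic f) (h : EuclideanSpace ℝ (Fin d)) :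
    ZdPeriodic (fun x => f (x + h)) := by
  intro x m
  have := hf (x + h) m
  simp only
  rw [← this]; congr 1; abel

theorem gradient_periodic {d : ℕ} {v : EuclideanSpace ℝ (Fin d) → ℝ} (hv : ZdPeriodic v) :
    ZdPeriodic (gradient v) := by
  intro x m
  unfold gradient
  rw [periodic_fderiv hv x m]

theorem rof_diff {d : ℕ}
    {u g : EuclideanSpace ℝ (Fin d) → ℝ}
    {z : EuclideanSpace ℝ (Fin d) → EuclideanSpace ℝ (Fin d)}
    (hu : ContDiff ℝ 1 u) (hg : ContDiff ℝ 1 g) (hz : ContDiff ℝ 1 z)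
    (huper : ZdPeriodic u) (hzper : ZdPeriodic z)
    (hz1 : ∀ x, ‖z x‖ ≤ 1)
    (hcomp : ∫ x in UnitCube d, ‖gradient u x‖ ≤
      ∫ x in UnitCube d, ⟪z x, gradient u x⟫)
    (heq : ∀ x, -diverg z x + u x = g x) (h : EuclideanSpace ℝ (Fin d)) :
    ∫ x in UnitCube d, (u (x + h) - u x) ^ 2 ≤ ∫ x in UnitCube d, (g (x + h) - g x) ^ 2 := by
  have huc := hu.continuous
  have hgc := hg.continuous
  have hzc := hz.continuous
  have hdu := gradient_cont hu
  have hdup := gradient_periodic huper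
  have hu' : ContDiff ℝ 1 (fun x => u (x + h)) := by fun_prop
  have hz' : ContDiff ℝ 1 (fun x => z (x + h)) := by fun_prop
  have ibp := cube_ibp (v := fun x => u (x + h) - u x) (w := fun x => z (x + h) - z x)
    (by fun_prop) (by fun_prop)
    (fun x m => by simp only [huper x m]; exact congrArg (· - u x) (periodic_shift huper h x m))
    (fun x m => by simp only [hzper x m]; exact congrArg (· - z x) (periodic_shift hzper h x m))
  have hdiv : ∀ x, diverg (fun x => z (x + h) - z x) x
      = (u (x + h) - u x) - (g (x + h) - g x) := by
    intro x
    have h1 : diverg (fun x => z (x + h) - z x) x = diverg z (x + h) - diverg z x := by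
      unfold diverg
      rw [fderiv_fun_sub (hz'.differentiable (by norm_num) x) (hz.differentiable (by norm_num) x),
        fderiv_comp_add_right, ← Finset.sum_sub_distrib]
      simp
    rw [h1, ← heq, ← heq]; ring
  have hgrad : ∀ x, gradient (fun x => u (x + h) - u x) x = gradient u (x + h) - gradient u x := by
    intro x
    unfold gradient
    rw [fderiv_fun_sub (hu'.differentiable (by norm_num) x) (hu.differentiable (by norm_num) x),
        fderiv_comp_add_right, map_sub]
  have p1 : ∫ x in UnitCube d, ‖gradient u (x + h)‖ = ∫ x in UnitCube d, ‖gradient u x‖ :=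
    cube_translate (f := fun x => ‖gradient u x‖) (fun x m => by simp only [hdup x m]) h
  have p2 : ∫ x in UnitCube d, ⟪z (x + h), gradient u (x + h)⟫
      = ∫ x in UnitCube d, ⟪z x, gradient u x⟫ :=
    cube_translate (f := fun x => ⟪z x, gradient u x⟫)
      (fun x m => by simp only [hdup x m, hzper x m]) h
  have cs : ∀ x y, ⟪z x, gradient u y⟫ ≤ ‖gradient u y‖ := fun x y =>
    (real_inner_le_norm _ _).trans (by nlinarith [hz1 x, norm_nonneg (gradient u y)])
  simp only [hdiv, hgrad] at ibp
  have i1 : Integrable (fun x => (u (x + h) - u x) ^ 2) (volume.restrict (UnitCube d)) :=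
    cube_integrable (by fun_prop)
  have i2 : Integrable (fun x => (g (x + h) - g x) ^ 2) (volume.restrict (UnitCube d)) :=
    cube_integrable (by fun_prop)
  have i3 : Integrable (fun x => ‖gradient u (x + h)‖) (volume.restrict (UnitCube d)) :=
    cube_integrable (by fun_prop)
  have i4 : Integrable (fun x => ‖gradient u x‖) (volume.restrict (UnitCube d)) :=
    cube_integrable (by fun_prop)
  have i5 : Integrable (fun x => ⟪z (x + h), gradient u (x + h)⟫) (volume.restrict (UnitCube d)) :=
    cube_integrable (by fun_prop)
  have i6 : Integrable (fun x => ⟪z x, gradient u x⟫) (volume.restrict (UnitCube d)) :=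
    cube_integrable (by fun_prop)
  have mono : ∫ x in UnitCube d, ((1 / 2 : ℝ) * ((u (x + h) - u x) ^ 2 - (g (x + h) - g x) ^ 2)
      + ((⟪z (x + h), gradient u (x + h)⟫ - ‖gradient u (x + h)‖)
        + (⟪z x, gradient u x⟫ - ‖gradient u x‖))) ≤ 0 := by
    rw [← ibp]
    refine integral_mono (((i1.sub i2).const_mul _).add ((i5.sub i3).add (i6.sub i4)))
      (cube_integrable (by fun_prop)) fun x => ?_
    simp only [inner_sub_left, inner_sub_right]
    nlinarith [cs x (x + h), cs (x + h) x,
      sq_nonneg ((u (x + h) - u x) - (g (x + h) - g x))]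
  have j1 : Integrable (fun x => (1 / 2 : ℝ) * ((u (x + h) - u x) ^ 2 - (g (x + h) - g x) ^ 2))
    (volume.restrict (UnitCube d)) := (i1.sub i2).const_mul _
  have j2 : Integrable (fun x => ⟪z (x + h), gradient u (x + h)⟫ - ‖gradient u (x + h)‖)
    (volume.restrict (UnitCube d)) := i5.sub i3
  have j3 : Integrable (fun x => ⟪z x, gradient u x⟫ - ‖gradient u x‖)
    (volume.restrict (UnitCube d)) := i6.sub i4
  have j4 : Integrable (fun x => (⟪z (x + h), gradient u (x + h)⟫ - ‖gradient u (x + h)‖) +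
    (⟪z x, gradient u x⟫ - ‖gradient u x‖)) (volume.restrict (UnitCube d)) := j2.add j3
  rw [integral_add j1 j4, integral_const_mul, integral_sub i1 i2, integral_add j2 j3, integral_sub i5 i3, integral_sub i6 i4, p1, p2] at mono
  linarith

theorem norm_grad_sq {d : ℕ} (v : EuclideanSpace ℝ (Fin d) → ℝ) (x : EuclideanSpace ℝ (Fin d)) :
    ‖gradient v x‖ ^ 2 = ∑ i, (fderiv ℝ v x (EuclideanSpace.single i 1)) ^ 2 := by
  rw [EuclideanSpace.real_norm_sq_eq]
  refine Finset.sum_congr rfl fun i _ => ?_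
  have : gradient v x i = ⟪gradient v x, EuclideanSpace.single i 1⟫ := by
    simp [EuclideanSpace.inner_single_right, -inner_gradient_left]
  rw [this, inner_gradient_left]

/-- gradient estimate for the ROF problem, Proposition 4.2 in the
smooth setting: the optimality conditions `|z| ≤ 1`, `∫|∇u| ≤ ∫ z·∇u` and
`-div z + u = g` imply `∫|∇u|² ≤ ∫|∇g|²`. -/
theorem rof_gradient_estimate (d : ℕ) (hd : 1 ≤ d)
    (u g : EuclideanSpace ℝ (Fin d) → ℝ)
    (z : EuclideanSpace ℝ (Fin d) → EuclideanSpace ℝ (Fin d))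
    (hu : ContDiff ℝ 1 u) (hg : ContDiff ℝ 1 g) (hz : ContDiff ℝ 2 z)
    (huper : ZdPeriodic u) (hgper : ZdPeriodic g) (hzper : ZdPeriodic z)
    (hz1 : ∀ x, ‖z x‖ ≤ 1)
    (hcomp : ∫ x in UnitCube d, ‖gradient u x‖ ≤
      ∫ x in UnitCube d, ⟪z x, gradient u x⟫)
    (heq : ∀ x, -diverg z x + u x = g x) :
    ∫ x in UnitCube d, ‖gradient u x‖ ^ 2 ≤ ∫ x in UnitCube d, ‖gradient g x‖ ^ 2 := by
  have hint : ∀ v : EuclideanSpace ℝ (Fin d) → ℝ, ContDiff ℝ 1 v → ∀ e,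
      Integrable (fun x => (fderiv ℝ v x e) ^ 2) (volume.restrict (UnitCube d)) := by
    intro v hv e
    have := hv.continuous_fderiv (by norm_num)
    exact cube_integrable (by fun_prop)
  simp only [norm_grad_sq]
  rw [integral_finsetSum _ fun i _ => hint u hu _, integral_finsetSum _ fun i _ => hint g hg _]
  refine Finset.sum_le_sum fun i _ => ?_
  refine le_of_tendsto_of_tendsto'
    (cube_slope hu (EuclideanSpace.single i 1) (φ := fun s => s ^ 2) (by fun_prop))
    (cube_slope hg (EuclideanSpace.single i 1) (φ := fun s => s ^ 2) (by fun_prop)) fun t => ?_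
  simp only [mul_pow]
  rw [integral_const_mul, integral_const_mul]
  exact mul_le_mul_of_nonneg_left (rof_diff hu hg (hz.of_le (by norm_num)) huper hzper hz1 hcomp
    heq _) (by positivity)

end
end

section
/- In the smooth solution setting for the approximated TV Wasserstein gradient flow on the torus (with parameters T > 0, ε ≥ 0, c ≥ 0), let β > c and suppose ρ(0, x) ≤ β for every x ∈ ℝᵈ. Then ρ(t, x) ≤ β for every t ∈ [0, T] and every x ∈ ℝᵈ. -/
open MeasureTheory
open scoped RealInnerProductSpace

noncomputable section

namespace TVMax

abbrev EE (d : ℕ) := EuclideanSpace ℝ (Fin d)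

abbrev bs (d : ℕ) : Module.Basis (Fin d) ℝ (EE d) := (EuclideanSpace.basisFun (Fin d) ℝ).toBasis

abbrev ev {d : ℕ} (i : Fin d) : EE d := EuclideanSpace.single i 1

lemma cube_eq (d : ℕ) : UnitCube d = ZSpan.fundamentalDomain (bs d) := by
  ext x
  simp [UnitCube, ZSpan.mem_fundamentalDomain]

lemma cube_meas (d : ℕ) : MeasurableSet (UnitCube d) := by
  rw [cube_eq]; exact ZSpan.fundamentalDomain_measurableSet _

lemma cube_bdd (d : ℕ) : Bornology.IsBounded (UnitCube d) := by
  rw [cube_eq]; exact ZSpan.fundamentalDomain_isBounded _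

lemma cube_cpt (d : ℕ) : IsCompact (closure (UnitCube d)) := (cube_bdd d).isCompact_closure

lemma cube_fin (d : ℕ) : volume (UnitCube d) < ⊤ := (cube_bdd d).measure_lt_top

instance cube_finm (d : ℕ) : IsFiniteMeasure (volume.restrict (UnitCube d)) :=
  ⟨by simpa using cube_fin d⟩

lemma cube_fd (d : ℕ) : IsAddFundamentalDomain (Submodule.span ℤ (Set.range (bs d))).toAddSubgroup
    (UnitCube d) volume := by
  rw [cube_eq]; exact ZSpan.isAddFundamentalDomain' _ _

instance cube_cnt (d : ℕ) : Countable (Submodule.span ℤ (Set.range (bs d))).toAddSubgroup :=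
  inferInstanceAs (Countable (Submodule.span ℤ (Set.range (bs d))))

lemma per_span {d : ℕ} {V : Type*} {f : EE d → V} (hf : ZdPeriodic f)
    (g : (Submodule.span ℤ (Set.range (bs d))).toAddSubgroup) (x : EE d) : f (g +ᵥ x) = f x := by
  obtain ⟨g, hg⟩ := g
  have := (Module.Basis.mem_span_iff_repr_mem ℤ (bs d) g).1 hg
  choose m hm using this
  have hx : (⟨g, hg⟩ : (Submodule.span ℤ (Set.range (bs d))).toAddSubgroup) +ᵥ x
      = x + (EuclideanSpace.equiv (Fin d) ℝ).symm (fun i => (m i : ℝ)) := by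
    rw [AddSubgroup.vadd_def]
    ext i
    have := hm i
    simp at this
    simp [this, add_comm]
  rw [hx, hf]

lemma integ {d : ℕ} {f : EE d → ℝ} (hf : Continuous f) : IntegrableOn f (UnitCube d) :=
  (hf.continuousOn.integrableOn_compact (cube_cpt d)).mono_set subset_closure

open scoped Pointwise in
lemma int_shift {d : ℕ} {f : EE d → ℝ} (hf : ZdPeriodic f) (a : EE d) :
    ∫ x in UnitCube d, f (x + a) = ∫ x in UnitCube d, f x := by
  have h1 : IsAddFundamentalDomain (Submodule.span ℤ (Set.range (bs d))).toAddSubgroup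
    (a +ᵥ UnitCube d) volume := (cube_fd d).vadd_of_comm a
  rw [← h1.setIntegral_eq (cube_fd d) (per_span hf)]
  have : a +ᵥ UnitCube d = (fun x => x + a) '' UnitCube d := by
    ext x; simp only [Set.mem_vadd_set, Set.mem_image, vadd_eq_add, add_comm]
  rw [this, MeasurePreserving.setIntegral_image_emb (measurePreserving_add_right volume a)
    (measurableEmbedding_addRight a)]

lemma deriv_int {d : ℕ} {F F' : ℝ → EE d → ℝ} {U : Set ℝ} (hU : IsOpen U) {s₀ : ℝ} (hs : s₀ ∈ U)
    (hF : ∀ s ∈ U, Continuous (F s))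
    (hF' : ContinuousOn (fun p : ℝ × EE d => F' p.1 p.2) (U ×ˢ Set.univ))
    (hd : ∀ s ∈ U, ∀ x, HasDerivAt (fun r => F r x) (F' s x) s) :
    HasDerivAt (fun s => ∫ x in UnitCube d, F s x) (∫ x in UnitCube d, F' s₀ x) s₀ := by
  obtain ⟨δ, hδ, hb⟩ := Metric.nhds_basis_closedBall.mem_iff.1 (hU.mem_nhds hs)
  obtain ⟨C, hC⟩ := ((isCompact_closedBall s₀ δ).prod (cube_cpt d)).exists_bound_of_continuousOn
    (hF'.mono (Set.prod_mono hb (Set.subset_univ _)))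
  have hc0 : Continuous (F' s₀) := by
    rw [← continuousOn_univ]
    exact hF'.comp (f := fun x : EE d => (s₀, x)) (by fun_prop) (fun x _ => ⟨hs, trivial⟩)
  refine (hasDerivAt_integral_of_dominated_loc_of_deriv_le (bound := fun _ => C)
    (Metric.closedBall_mem_nhds s₀ hδ) ?_ (integ (hF _ hs)) hc0.aestronglyMeasurable ?_
    (integrable_const _) ?_).2
  · filter_upwards [hU.mem_nhds hs] with s h using (hF s h).aestronglyMeasurable
  · filter_upwards [ae_restrict_mem (cube_meas d)] with x hx s h
    exact hC (s, x) ⟨h, subset_closure hx⟩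
  · exact Filter.Eventually.of_forall fun x s h => hd s (hb h) x

lemma cont_int {d : ℕ} {F : ℝ → EE d → ℝ} {U : Set ℝ} (hU : IsCompact U)
    (hF : ContinuousOn (fun p : ℝ × EE d => F p.1 p.2) (U ×ˢ Set.univ)) :
    ContinuousOn (fun s => ∫ x in UnitCube d, F s x) U := by
  obtain ⟨C, hC⟩ := (hU.prod (cube_cpt d)).exists_bound_of_continuousOn
    (hF.mono (Set.prod_mono subset_rfl (Set.subset_univ _)))
  refine continuousOn_of_dominated (bound := fun _ => C) ?_ ?_ (integrable_const _) ?_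
  · intro s hs
    apply Continuous.aestronglyMeasurable
    rw [← continuousOn_univ]
    exact hF.comp (f := fun x : EE d => (s, x)) (by fun_prop) (fun x _ => ⟨hs, trivial⟩)
  · intro s hs
    filter_upwards [ae_restrict_mem (cube_meas d)] with x hx
    exact hC (s, x) ⟨hs, subset_closure hx⟩
  · refine Filter.Eventually.of_forall fun x => ?_
    exact hF.comp (f := fun s : ℝ => (s, x)) (by fun_prop) (fun s h => ⟨h, trivial⟩)

/-- Directional derivative. -/
def D {d : ℕ} (e : EE d) (f : EE d → ℝ) (x : EE d) : ℝ := fderiv ℝ f x e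

lemma D_smooth {d : ℕ} {f : EE d → ℝ} (hf : ContDiff ℝ (⊤ : ℕ∞) f) (e : EE d) :
    ContDiff ℝ (⊤ : ℕ∞) (D e f) := by
  unfold D
  exact (hf.fderiv_right (m := (⊤ : ℕ∞)) (by simp)).clm_apply contDiff_const

lemma D_per {d : ℕ} {f : EE d → ℝ} (hf : ZdPeriodic f) (e : EE d) : ZdPeriodic (D e f) := by
  intro x m
  unfold D
  rw [← fderiv_comp_add_right]
  congr 2
  ext y
  exact hf y m

lemma line_deriv {d : ℕ} {f : EE d → ℝ} (hf : ContDiff ℝ (⊤ : ℕ∞) f) (e x : EE d) (s : ℝ) :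
    HasDerivAt (fun r : ℝ => f (x + r • e)) (D e f (x + s • e)) s := by
  have h1 : HasFDerivAt f (fderiv ℝ f (x + s • e)) (x + s • e) :=
    (hf.differentiable (by simp) _).hasFDerivAt
  have h2 : HasDerivAt (fun r : ℝ => x + r • e) e s := by
    simpa using ((hasDerivAt_id s).smul_const e).const_add x
  exact h1.comp_hasDerivAt s h2

lemma int_D {d : ℕ} {f : EE d → ℝ} (hf : ContDiff ℝ (⊤ : ℕ∞) f) (hp : ZdPeriodic f) (e : EE d) :
    ∫ x in UnitCube d, D e f x = 0 := by
  have hc := (D_smooth hf e).continuous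
  have hc' := hf.continuous
  have h := deriv_int (F := fun s x => f (x + s • e)) (F' := fun s x => D e f (x + s • e))
    isOpen_univ (Set.mem_univ (0:ℝ)) (fun s _ => by fun_prop) (by fun_prop)
    (fun s _ x => line_deriv hf e x s)
  simp only [int_shift hp, zero_smul, add_zero] at h
  exact h.unique (hasDerivAt_const _ _)

lemma D_mul {d : ℕ} {f g : EE d → ℝ} (hf : ContDiff ℝ (⊤ : ℕ∞) f) (hg : ContDiff ℝ (⊤ : ℕ∞) g)
    (e x : EE d) : D e (fun y => f y * g y) x = f x * D e g x + D e f x * g x := by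
  unfold D
  rw [fderiv_fun_mul (hf.differentiable (by simp) _) (hg.differentiable (by simp) _)]
  simp; ring

lemma per_mul {d : ℕ} {f g : EE d → ℝ} (hf : ZdPeriodic f) (hg : ZdPeriodic g) :
    ZdPeriodic (fun y => f y * g y) := fun x m => by simp only [hf x m, hg x m]

lemma per_shift {d : ℕ} {f : EE d → ℝ} (hf : ZdPeriodic f) (a : EE d) :
    ZdPeriodic (fun y => f (y + a)) := fun x m => by
  simp only []
  rw [add_right_comm, hf]

lemma int_parts {d : ℕ} {f g : EE d → ℝ} (hf : ContDiff ℝ (⊤ : ℕ∞) f)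
    (hg : ContDiff ℝ (⊤ : ℕ∞) g) (pf : ZdPeriodic f) (pg : ZdPeriodic g) (e : EE d) :
    ∫ x in UnitCube d, f x * D e g x = - ∫ x in UnitCube d, D e f x * g x := by
  have h := int_D (hf.mul hg) (per_mul pf pg) e
  have c1 := (D_smooth hf e).continuous
  have c2 := (D_smooth hg e).continuous
  have c3 := hf.continuous
  have c4 := hg.continuous
  have h2 : ∫ x in UnitCube d, D e (fun y => f y * g y) x =
    ∫ x in UnitCube d, (f x * D e g x + D e f x * g x) := by
    congr 1; ext x; exact D_mul hf hg e x
  rw [h2, integral_add (integ (by fun_prop)) (integ (by fun_prop))] at h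
  linarith

lemma D_shift {d : ℕ} (f : EE d → ℝ) (e a x : EE d) :
    D e (fun y => f (y + a)) x = D e f (x + a) := by
  unfold D; rw [fderiv_comp_add_right]

/-- if `∫ g v(·+a)` is minimal at `a = 0` then `∫ D g D v ≤ 0`. -/
lemma second_var {d : ℕ} {g v : EE d → ℝ} (hg : ContDiff ℝ (⊤ : ℕ∞) g)
    (hv : ContDiff ℝ (⊤ : ℕ∞) v) (pg : ZdPeriodic g) (pv : ZdPeriodic v) (e : EE d)
    (hmin : ∀ a, ∫ x in UnitCube d, g x * v x ≤ ∫ x in UnitCube d, g x * v (x + a)) :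
    ∫ x in UnitCube d, D e g x * D e v x ≤ 0 := by
  have c1 := hg.continuous
  have c2 := hv.continuous
  have c3 := (D_smooth hv e).continuous
  have c4 := (D_smooth (D_smooth hv e) e).continuous
  have h1 : ∀ s : ℝ, HasDerivAt (fun s : ℝ => ∫ x in UnitCube d, g x * v (x + s • e))
      (∫ x in UnitCube d, g x * D e v (x + s • e)) s := fun s =>
    deriv_int (F := fun s x => g x * v (x + s • e)) (F' := fun s x => g x * D e v (x + s • e))
      isOpen_univ (Set.mem_univ s) (fun s _ => by fun_prop) (by fun_prop)
      (fun s _ x => (line_deriv hv e x s).const_mul _)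
  have h2 : ∀ s : ℝ, HasDerivAt (fun s : ℝ => ∫ x in UnitCube d, g x * D e v (x + s • e))
      (∫ x in UnitCube d, g x * D e (D e v) (x + s • e)) s := fun s =>
    deriv_int (F := fun s x => g x * D e v (x + s • e))
      (F' := fun s x => g x * D e (D e v) (x + s • e))
      isOpen_univ (Set.mem_univ s) (fun s _ => by fun_prop) (by fun_prop)
      (fun s _ x => (line_deriv (D_smooth hv e) e x s).const_mul _)
  have h3 := int_parts hg (D_smooth hv e) pg (D_per pv e) e
  set φ : ℝ → ℝ := fun s : ℝ => ∫ x in UnitCube d, g x * v (x + s • e) with hφ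
  have hdφ : deriv φ = fun s : ℝ => ∫ x in UnitCube d, g x * D e v (x + s • e) :=
    funext fun s => (h1 s).deriv
  have hddφ : deriv (deriv φ) 0 = ∫ x in UnitCube d, g x * D e (D e v) x := by
    rw [hdφ, (h2 0).deriv]; simp
  have hm : IsLocalMin φ 0 := Filter.Eventually.of_forall fun s => by
    simpa [hφ] using hmin (s • e)
  by_contra! hcon
  have hneg : deriv (deriv φ) 0 < 0 := by rw [hddφ, h3]; linarith
  have hM : IsLocalMax φ 0 :=
    isLocalMax_of_deriv_deriv_neg hneg hm.deriv_eq_zero (h1 0).continuousAt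
  have hEq : φ =ᶠ[nhds 0] fun _ => φ 0 := by
    filter_upwards [hm, hM] with s a b using le_antisymm b a
  have := (hEq.deriv.deriv).eq_of_nhds
  simp at this
  rw [this] at hneg
  exact lt_irrefl _ hneg

lemma per_fderiv {d : ℕ} {f : EE d → ℝ} (hf : ZdPeriodic f) :
    ZdPeriodic (fun x => ‖fderiv ℝ f x‖) := by
  intro x m
  simp only []
  rw [← fderiv_comp_add_right]
  congr 2
  ext y
  exact hf y m

lemma vec_sum {d : ℕ} (x : EE d) : x = ∑ i, x i • ev i := by
  ext j
  simp [Finset.sum_apply, Pi.single_apply]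

lemma fderiv_sum {d : ℕ} (v : EE d → ℝ) (y x : EE d) :
    fderiv ℝ v y x = ∑ i, x i * D (ev i) v y := by
  conv_lhs => rw [vec_sum x]
  simp [D]

lemma grad_coord {d : ℕ} (f : EE d → ℝ) (x : EE d) (i : Fin d) :
    gradient f x i = D (ev i) f x := by
  have := inner_gradient_left (𝕜 := ℝ) (f := f) (x := x) (y := ev i)
  rw [D, ← this]
  exact (by simpa using (EuclideanSpace.inner_single_right (𝕜 := ℝ) i 1 (gradient f x)).symm)

lemma diverg_eq {d : ℕ} {w : EE d → EE d} (hw : Differentiable ℝ w) (x : EE d) :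
    diverg w x = ∑ i, D (ev i) (fun y => w y i) x := by
  unfold diverg D
  refine Finset.sum_congr rfl fun i _ => ?_
  have h : HasFDerivAt (fun y => w y i) ((EuclideanSpace.proj i).comp (fderiv ℝ w x)) x :=
    (EuclideanSpace.proj (𝕜 := ℝ) i).hasFDerivAt.comp x (hw x).hasFDerivAt
  rw [h.fderiv]
  rfl

lemma coord_smooth {d : ℕ} {w : EE d → EE d} (hw : ContDiff ℝ (⊤ : ℕ∞) w) (i : Fin d) :
    ContDiff ℝ (⊤ : ℕ∞) (fun y => w y i) :=
  (EuclideanSpace.proj (𝕜 := ℝ) i).contDiff.comp hw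

lemma diverg_smooth {d : ℕ} {w : EE d → EE d} (hw : ContDiff ℝ (⊤ : ℕ∞) w) :
    ContDiff ℝ (⊤ : ℕ∞) (diverg w) := by
  have : diverg w = fun x => ∑ i, D (ev i) (fun y => w y i) x :=
    funext fun x => diverg_eq (hw.differentiable (by simp)) x
  rw [this]
  exact ContDiff.sum fun i _ => D_smooth (coord_smooth hw i) _

lemma diverg_per {d : ℕ} {w : EE d → EE d} (hw : ZdPeriodic w) : ZdPeriodic (diverg w) := by
  intro x m
  unfold diverg
  rw [← fderiv_comp_add_right]
  have : (fun y => w (y + (EuclideanSpace.equiv (Fin d) ℝ).symm (fun i => (m i : ℝ)))) = w :=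
    funext fun y => hw y m
  rw [this]

lemma D_pow {d : ℕ} {u : EE d → ℝ} (hu : ContDiff ℝ (⊤ : ℕ∞) u) (n : ℕ) (e x : EE d) :
    D e (fun y => u y ^ n) x = n * u x ^ (n - 1) * D e u x := by
  unfold D
  have h := ((hu.differentiable (by simp) x).hasFDerivAt.pow n)
  rw [h.fderiv]
  simp

lemma int_fderiv_shift {d : ℕ} {w : EE d → EE d} {v : EE d → ℝ} (hw : ContDiff ℝ (⊤ : ℕ∞) w)
    (hv : ContDiff ℝ (⊤ : ℕ∞) v) (pw : ZdPeriodic w) (pv : ZdPeriodic v) (a : EE d) :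
    ∫ x in UnitCube d, diverg w x * v (x + a) =
      - ∫ x in UnitCube d, fderiv ℝ v (x + a) (w x) := by
  have hva : ContDiff ℝ (⊤ : ℕ∞) (fun x => v (x + a)) := hv.comp (contDiff_id.add contDiff_const)
  have hwi := fun i => coord_smooth hw i
  have pwi : ∀ i, ZdPeriodic (fun x => w x i) := fun i x m => by simp only [pw x m]
  have c1 : ∀ i, Continuous (D (ev i) (fun y => w y i)) := fun i =>
    (D_smooth (hwi i) _).continuous
  have c2 := hva.continuous
  have c3 : ∀ i : Fin d, Continuous (D (ev i) v) := fun i => (D_smooth hv _).continuous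
  have c4 : ∀ i, Continuous (fun y => w y i) := fun i => (hwi i).continuous
  simp_rw [diverg_eq (hw.differentiable (by simp)), fderiv_sum, Finset.sum_mul]
  rw [integral_finsetSum _ (fun i _ => integ (by have := c1 i; fun_prop)),
    integral_finsetSum _ (fun i _ => integ (by have := c3 i; have := c4 i; fun_prop)),
    ← Finset.sum_neg_distrib]
  refine Finset.sum_congr rfl fun i _ => ?_
  have := int_parts (hwi i) hva (pwi i) (per_shift pv a) (ev i)
  simp_rw [D_shift] at this
  rw [this]; simp

lemma min_cond {d : ℕ} {w : EE d → EE d} {u : EE d → ℝ} (hw : ContDiff ℝ (⊤ : ℕ∞) w)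
    (hu : ContDiff ℝ (⊤ : ℕ∞) u) (pw : ZdPeriodic w) (pu : ZdPeriodic u)
    (hu0 : ∀ x, 0 < u x) (hw1 : ∀ x, ‖w x‖ ≤ 1)
    (hcomp : ∫ x in UnitCube d, ‖gradient u x‖ ≤ ∫ x in UnitCube d, ⟪w x, gradient u x⟫)
    (n : ℕ) (a : EE d) :
    ∫ x in UnitCube d, diverg w x * u x ^ n ≤ ∫ x in UnitCube d, diverg w x * u (x + a) ^ n := by
  have hv : ContDiff ℝ (⊤ : ℕ∞) (fun x => u x ^ n) := hu.pow n
  have pv : ZdPeriodic (fun x => u x ^ n) := fun x m => by simp only [pu x m]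
  have e0 := int_fderiv_shift hw hv pw pv 0
  have e1 := int_fderiv_shift hw hv pw pv a
  simp only [add_zero] at e0
  rw [e0, e1, neg_le_neg_iff]
  have cw := hw.continuous
  have cdu : Continuous (fderiv ℝ u) := hu.continuous_fderiv (by simp)
  have cdv : Continuous (fderiv ℝ (fun x => u x ^ n)) := hv.continuous_fderiv (by simp)
  have hle : ∀ (L : EE d →L[ℝ] ℝ) x, L (w x) ≤ ‖L‖ := fun L x =>
    (le_abs_self _).trans ((L.le_opNorm (w x)).trans
      (mul_le_of_le_one_right (norm_nonneg _) (hw1 x)))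
  have hg1 : ∀ x, ‖gradient u x‖ = ‖fderiv ℝ u x‖ := fun x => by
    simp [gradient]
  have hg2 : ∀ x, ⟪w x, gradient u x⟫ = fderiv ℝ u x (w x) := fun x => by
    rw [inner_gradient_right]; simp
  simp_rw [hg1, hg2] at hcomp
  have i1 : IntegrableOn (fun x => ‖fderiv ℝ u x‖) (UnitCube d) := integ (by fun_prop)
  have i2 : IntegrableOn (fun x => fderiv ℝ u x (w x)) (UnitCube d) := integ (by fun_prop)
  have hz : ∫ x in UnitCube d, (‖fderiv ℝ u x‖ - fderiv ℝ u x (w x)) = 0 := by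
    apply le_antisymm
    · rw [integral_sub i1 i2]; linarith
    · exact integral_nonneg fun x => sub_nonneg.2 (hle _ x)
  have hae := (integral_eq_zero_iff_of_nonneg (fun x => sub_nonneg.2 (hle _ x)) (i1.sub i2)).1 hz
  calc ∫ x in UnitCube d, fderiv ℝ (fun x => u x ^ n) (x + a) (w x)
      ≤ ∫ x in UnitCube d, ‖fderiv ℝ (fun x => u x ^ n) (x + a)‖ :=
        integral_mono (integ (by fun_prop)) (integ (by fun_prop)) fun x => hle _ x
    _ = ∫ x in UnitCube d, ‖fderiv ℝ (fun x => u x ^ n) x‖ := int_shift (per_fderiv pv) a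
    _ = ∫ x in UnitCube d, fderiv ℝ (fun x => u x ^ n) x (w x) := by
        apply integral_congr_ae
        filter_upwards [hae] with x hx
        have h := ((hu.differentiable (by simp) x).hasFDerivAt.pow n)
        have hx' : ‖fderiv ℝ u x‖ = fderiv ℝ u x (w x) := sub_eq_zero.1 hx
        have hp := (hu0 x).le
        rw [h.fderiv, norm_smul, hx']
        simp only [smul_apply, smul_eq_mul, Real.norm_eq_abs]
        rw [abs_of_nonneg (by positivity)]

lemma key {d : ℕ} {w : EE d → EE d} {u : EE d → ℝ} {ε c : ℝ} (hε : 0 ≤ ε) (hc : 0 ≤ c)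
    (hw : ContDiff ℝ (⊤ : ℕ∞) w)
    (hu : ContDiff ℝ (⊤ : ℕ∞) u) (pw : ZdPeriodic w) (pu : ZdPeriodic u)
    (huc : ∀ x, c < u x) (hw1 : ∀ x, ‖w x‖ ≤ 1)
    (hcomp : ∫ x in UnitCube d, ‖gradient u x‖ ≤ ∫ x in UnitCube d, ⟪w x, gradient u x⟫)
    (n : ℕ) :
    0 ≤ ∫ x in UnitCube d, u x ^ n * diverg (fun y => u y •
          gradient (fun w' => diverg w w' + ε / (u w' - c) ^ 2) y) x := by
  have hu0 : ∀ x, 0 < u x := fun x => hc.trans_lt (huc x)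
  set p : EE d → ℝ := fun w' => diverg w w' + ε / (u w' - c) ^ 2 with hp
  have hne : ∀ x, (u x - c) ^ 2 ≠ 0 := fun x => pow_ne_zero _ (sub_pos.2 (huc x)).ne'
  have hκ : ContDiff ℝ (⊤ : ℕ∞) (fun x => ε / (u x - c) ^ 2) :=
    contDiff_const.div ((hu.sub contDiff_const).pow 2) hne
  have hg := diverg_smooth hw
  have pg := diverg_per pw
  have hps : ContDiff ℝ (⊤ : ℕ∞) p := hg.add hκ
  have pp : ZdPeriodic p := fun x m => by simp only [hp, pg x m, pu x m]
  have hgr : ContDiff ℝ (⊤ : ℕ∞) (gradient p) := by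
    have : gradient p = fun x => (InnerProductSpace.toDual ℝ (EE d)).symm (fderiv ℝ p x) := rfl
    rw [this]
    exact ((InnerProductSpace.toDual ℝ (EE d)).symm.contDiff).comp
      (hps.fderiv_right (m := (⊤ : ℕ∞)) (by simp))
  have hdv : ∀ x, diverg (fun y => u y • gradient p y) x =
      ∑ i, D (ev i) (fun y => u y * D (ev i) p y) x := fun x => by
    have hsm : ContDiff ℝ (⊤ : ℕ∞) (fun y => u y • gradient p y) := hu.smul hgr
    rw [diverg_eq (hsm.differentiable (by simp))]
    simp [grad_coord]
  simp_rw [hdv, Finset.mul_sum]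
  have hun : ContDiff ℝ (⊤ : ℕ∞) (fun x => u x ^ n) := hu.pow n
  have pun : ZdPeriodic (fun x => u x ^ n) := fun x m => by simp only [pu x m]
  have hv : ContDiff ℝ (⊤ : ℕ∞) (fun x => u x ^ (n + 1)) := hu.pow _
  have pv : ZdPeriodic (fun x => u x ^ (n + 1)) := fun x m => by simp only [pu x m]
  have hud : ∀ i : Fin d, ContDiff ℝ (⊤ : ℕ∞) (fun y => u y * D (ev i) p y) := fun i =>
    hu.mul (D_smooth hps _)
  have pud : ∀ i : Fin d, ZdPeriodic (fun y => u y * D (ev i) p y) := fun i =>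
    per_mul pu (D_per pp _)
  rw [integral_finsetSum _ (fun i _ => integ (by
    have := hun.continuous; have := (D_smooth (hud i) (ev i)).continuous; fun_prop))]
  refine Finset.sum_nonneg fun i _ => ?_
  rw [int_parts hun (hud i) pun (pud i), neg_nonneg]
  have hsv := second_var hg hv pg pv (ev i)
    (fun a => min_cond hw hu pw pu hu0 hw1 hcomp (n + 1) a)
  have hDκ : ∀ x, D (ev i) (fun x => ε / (u x - c) ^ 2) x =
      -(2 * ε / (u x - c) ^ 3) * D (ev i) u x := fun x => by
    have h1 := (hu.differentiable (by simp) x).hasFDerivAt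
    have hpos := sub_pos.2 (huc x)
    have h2 : HasDerivAt (fun s : ℝ => ε / (s - c) ^ 2) (-(2 * ε / (u x - c) ^ 3)) (u x) := by
      have := (hasDerivAt_const (u x) ε).div (((hasDerivAt_id (u x)).sub_const c).pow 2) (hne x)
      refine this.congr_deriv ?_
      simp
      field_simp
    have := h2.comp_hasFDerivAt x h1
    unfold D
    rw [show (fun x => ε / (u x - c) ^ 2) = (fun s : ℝ => ε / (s - c) ^ 2) ∘ u from rfl,
      this.fderiv]
    simp
  have hDp : ∀ x, D (ev i) p x = D (ev i) (diverg w) x +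
      -(2 * ε / (u x - c) ^ 3) * D (ev i) u x := fun x => by
    rw [← hDκ]
    unfold D
    rw [hp, fderiv_fun_add (hg.differentiable (by simp) x) (hκ.differentiable (by simp) x)]
    rfl
  have cDu : Continuous (D (ev i) u) := (D_smooth hu _).continuous
  have cDg : Continuous (D (ev i) (diverg w)) := (D_smooth hg _).continuous
  have cDv : Continuous (D (ev i) (fun x => u x ^ (n + 1))) := (D_smooth hv _).continuous
  have cu := hu.continuous
  have hn1 : (0:ℝ) < n + 1 := by positivity
  have hpt : ∀ x, D (ev i) (fun x => u x ^ n) x * (u x * D (ev i) p x) ≤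
      (n / (n + 1) : ℝ) * (D (ev i) (diverg w) x * D (ev i) (fun x => u x ^ (n + 1)) x) := by
    intro x
    have hpos := sub_pos.2 (huc x)
    have hupos := hu0 x
    have hpw : (n : ℝ) * u x ^ (n - 1) * u x = n * u x ^ n := by
      rcases n with _ | n
      · simp
      · simp [pow_succ]; ring
    rw [D_pow hu, D_pow hu, hDp]
    have e1 : (n : ℝ) * u x ^ (n - 1) * D (ev i) u x * (u x * (D (ev i) (diverg w) x +
      -(2 * ε / (u x - c) ^ 3) * D (ev i) u x)) =
      n * u x ^ n * D (ev i) u x * D (ev i) (diverg w) x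
       - n * u x ^ n * (2 * ε / (u x - c) ^ 3) * D (ev i) u x ^ 2 := by
      rw [← hpw]; ring
    have e2 : (n / (n + 1) : ℝ) * (D (ev i) (diverg w) x *
       (((n + 1 : ℕ) : ℝ) * u x ^ (n + 1 - 1) * D (ev i) u x)) =
       n * u x ^ n * D (ev i) u x * D (ev i) (diverg w) x := by
      rw [Nat.add_sub_cancel]
      push_cast
      field_simp
    rw [e1, e2]
    have : 0 ≤ n * u x ^ n * (2 * ε / (u x - c) ^ 3) * D (ev i) u x ^ 2 := by positivity
    linarith
  calc _ ≤ ∫ x in UnitCube d, (n / (n + 1) : ℝ) *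
        (D (ev i) (diverg w) x * D (ev i) (fun x => u x ^ (n + 1)) x) :=
        integral_mono (integ ((D_smooth hun _).continuous.mul (hud i).continuous))
          (integ (by fun_prop)) hpt
    _ ≤ 0 := by
        rw [integral_const_mul]
        exact mul_nonpos_of_nonneg_of_nonpos (by positivity) hsv

open scoped Pointwise in
lemma limit_arg {d : ℕ} {u : EE d → ℝ} {β : ℝ} (hβ : 0 < β) (cu : Continuous u)
    (pu : ZdPeriodic u) (hu0 : ∀ x, 0 < u x)
    (h : ∀ n : ℕ, ∫ x in UnitCube d, u x ^ (n + 1) ≤ ∫ _x in UnitCube d, β ^ (n + 1)) :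
    ∀ x, u x ≤ β := by
  by_contra! hcon
  obtain ⟨x₀, hx₀⟩ := hcon
  obtain ⟨b, hb1, hb2⟩ := exists_between hx₀
  set U : Set (EE d) := {x | b < u x} with hU
  have hUo : IsOpen U := isOpen_lt continuous_const cu
  have hμU : volume U ≠ 0 := hUo.measure_ne_zero _ ⟨x₀, hb2⟩
  have hμ : volume (U ∩ UnitCube d) ≠ 0 := by
    intro h0
    refine hμU ((cube_fd d).measure_zero_of_invariant U (fun g => ?_) h0)
    ext x
    rw [Set.mem_vadd_set_iff_neg_vadd_mem]
    simp only [hU, Set.mem_ofPred_eq, per_span pu]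
  set m := volume.real (U ∩ UnitCube d) with hm
  have hfin : volume (U ∩ UnitCube d) ≠ ⊤ :=
    ((measure_mono Set.inter_subset_right).trans_lt (cube_fin d)).ne
  have hmpos : 0 < m := ENNReal.toReal_pos hμ hfin
  have hlow : ∀ n : ℕ, m * b ^ (n + 1) ≤ volume.real (UnitCube d) * β ^ (n + 1) := by
    intro n
    have h1 : ∫ _x in U ∩ UnitCube d, b ^ (n + 1) ≤ ∫ x in U ∩ UnitCube d, u x ^ (n + 1) := by
      refine setIntegral_mono_on (integrableOn_const hfin)
        ((integ (by fun_prop)).mono_set Set.inter_subset_right)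
        (hUo.measurableSet.inter (cube_meas d)) fun x hx => ?_
      exact pow_le_pow_left₀ (hβ.trans hb1).le (le_of_lt hx.1) _
    have h2 : ∫ x in U ∩ UnitCube d, u x ^ (n + 1) ≤ ∫ x in UnitCube d, u x ^ (n + 1) :=
      setIntegral_mono_set (integ (by fun_prop))
        (Filter.Eventually.of_forall fun x => (pow_pos (hu0 x) _).le)
        (Filter.Eventually.of_forall Set.inter_subset_right)
    have h3 := h n
    simp only [setIntegral_const, smul_eq_mul] at h1 h3
    linarith
  have hr : 1 < b / β := (one_lt_div hβ).2 hb1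
  obtain ⟨n, hn⟩ := pow_unbounded_of_one_lt (volume.real (UnitCube d) / m) hr
  have hn' : volume.real (UnitCube d) / m < (b / β) ^ (n + 1) :=
    hn.trans (pow_lt_pow_right₀ hr (Nat.lt_succ_self n))
  rw [div_pow, div_lt_div_iff₀ hmpos (pow_pos hβ _)] at hn'
  have := hlow n
  linarith

end TVMax

/-- maximum principle: in the smooth solution setting for the
approximated TV Wasserstein gradient flow `∂ₜρ + div(ρ ∇(div z - f'(ρ))) = 0`
(with `f(s) = ε/(s-c)`, so `-f'(ρ) = ε/(ρ-c)²`), any upper bound `β > c` on the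
initial density propagates in time. -/
theorem maximum_principle (d : ℕ) (hd : 1 ≤ d) (T ε c : ℝ)
    (hT : 0 < T) (hε : 0 ≤ ε) (hc : 0 ≤ c)
    (ρ : ℝ → EuclideanSpace ℝ (Fin d) → ℝ)
    (z : ℝ → EuclideanSpace ℝ (Fin d) → EuclideanSpace ℝ (Fin d))
    (hρsm : ContDiffOn ℝ (⊤ : ℕ∞) (fun p : ℝ × EuclideanSpace ℝ (Fin d) => ρ p.1 p.2)
      (Set.Icc 0 T ×ˢ Set.univ))
    (hzsm : ContDiffOn ℝ (⊤ : ℕ∞) (fun p : ℝ × EuclideanSpace ℝ (Fin d) => z p.1 p.2)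
      (Set.Icc 0 T ×ˢ Set.univ))
    (hρper : ∀ t ∈ Set.Icc (0 : ℝ) T, ZdPeriodic (ρ t))
    (hzper : ∀ t ∈ Set.Icc (0 : ℝ) T, ZdPeriodic (z t))
    (hρc : ∀ t ∈ Set.Icc (0 : ℝ) T, ∀ x, c < ρ t x)
    (hz1 : ∀ t ∈ Set.Icc (0 : ℝ) T, ∀ x, ‖z t x‖ ≤ 1)
    (hcomp : ∀ t ∈ Set.Icc (0 : ℝ) T,
      ∫ x in UnitCube d, ‖gradient (ρ t) x‖ ≤
        ∫ x in UnitCube d, ⟪z t x, gradient (ρ t) x⟫)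
    (hpde : ∀ t ∈ Set.Icc (0 : ℝ) T, ∀ x,
      deriv (fun s => ρ s x) t +
        diverg (fun y => ρ t y •
          gradient (fun w => diverg (z t) w + ε / (ρ t w - c) ^ 2) y) x = 0)
    (β : ℝ) (hβ : c < β) (h0 : ∀ x, ρ 0 x ≤ β) :
    ∀ t ∈ Set.Icc (0 : ℝ) T, ∀ x, ρ t x ≤ β := by
  have hsl : ∀ t ∈ Set.Icc (0 : ℝ) T, ContDiff ℝ (⊤ : ℕ∞) (ρ t) := fun t ht => by
    rw [← contDiffOn_univ]
    exact hρsm.comp (f := fun x : EuclideanSpace ℝ (Fin d) => (t, x)) (by fun_prop)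
      (fun x _ => ⟨ht, trivial⟩)
  have hzl : ∀ t ∈ Set.Icc (0 : ℝ) T, ContDiff ℝ (⊤ : ℕ∞) (z t) := fun t ht => by
    rw [← contDiffOn_univ]
    exact hzsm.comp (f := fun x : EuclideanSpace ℝ (Fin d) => (t, x)) (by fun_prop)
      (fun x _ => ⟨ht, trivial⟩)
  have hβ0 : 0 < β := hc.trans_lt hβ
  have h00 : (0 : ℝ) ∈ Set.Icc (0 : ℝ) T := ⟨le_rfl, hT.le⟩
  set O : Set (ℝ × EuclideanSpace ℝ (Fin d)) := Set.Ioo 0 T ×ˢ Set.univ with hO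
  have hOo : IsOpen O := isOpen_Ioo.prod isOpen_univ
  have hρO := hρsm.mono (Set.prod_mono Set.Ioo_subset_Icc_self (subset_refl Set.univ))
  have hcd := hρO.continuousOn_fderiv_of_isOpen hOo (by simp)
  have hder : ∀ s ∈ Set.Ioo (0 : ℝ) T, ∀ x, HasDerivAt (fun r => ρ r x)
      (fderiv ℝ (fun p : ℝ × EuclideanSpace ℝ (Fin d) => ρ p.1 p.2) (s, x) (1, 0)) s := by
    intro s hs x
    have hda : DifferentiableAt ℝ (fun p : ℝ × EuclideanSpace ℝ (Fin d) => ρ p.1 p.2) (s, x) :=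
      (hρO.differentiableOn (by simp)).differentiableAt (hOo.mem_nhds ⟨hs, trivial⟩)
    have h2 : HasDerivAt (fun r : ℝ => (r, x)) ((1 : ℝ), (0 : EuclideanSpace ℝ (Fin d))) s :=
      (hasDerivAt_id s).prodMk (hasDerivAt_const s x)
    exact hda.hasFDerivAt.comp_hasDerivAt s h2
  have hanti : ∀ n : ℕ, AntitoneOn (fun t => ∫ x in UnitCube d, ρ t x ^ (n + 1))
      (Set.Icc 0 T) := by
    intro n
    have hD : ∀ s ∈ Set.Ioo (0 : ℝ) T,
        HasDerivAt (fun t => ∫ x in UnitCube d, ρ t x ^ (n + 1))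
          (∫ x in UnitCube d, ((n + 1 : ℕ) : ℝ) * ρ s x ^ n *
            fderiv ℝ (fun p : ℝ × EuclideanSpace ℝ (Fin d) => ρ p.1 p.2) (s, x) (1, 0)) s := by
      intro s hs
      refine TVMax.deriv_int (F := fun t x => ρ t x ^ (n + 1))
        (F' := fun s x => ((n + 1 : ℕ) : ℝ) * ρ s x ^ n *
            fderiv ℝ (fun p : ℝ × EuclideanSpace ℝ (Fin d) => ρ p.1 p.2) (s, x) (1, 0))
        isOpen_Ioo hs ?_ ?_ ?_
      · intro t ht
        exact (hsl t (Set.Ioo_subset_Icc_self ht)).continuous.pow _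
      · exact (continuousOn_const.mul (hρO.continuousOn.pow n)).mul
          (hcd.clm_apply continuousOn_const)
      · intro t ht x
        exact (hder t ht x).fun_pow (n + 1)
    refine antitoneOn_of_deriv_nonpos (convex_Icc 0 T) ?_ ?_ ?_
    · exact TVMax.cont_int (F := fun t x => ρ t x ^ (n + 1)) isCompact_Icc
        (hρsm.continuousOn.pow _)
    · rw [interior_Icc]
      exact fun s hs => (hD s hs).differentiableAt.differentiableWithinAt
    · rw [interior_Icc]
      intro s hs
      have hs' := Set.Ioo_subset_Icc_self hs
      rw [(hD s hs).deriv]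
      have hk := TVMax.key hε hc (hzl s hs') (hsl s hs') (hzper s hs') (hρper s hs')
        (hρc s hs') (hz1 s hs') (hcomp s hs') n
      have heq : ∀ x, ((n + 1 : ℕ) : ℝ) * ρ s x ^ n *
            fderiv ℝ (fun p : ℝ × EuclideanSpace ℝ (Fin d) => ρ p.1 p.2) (s, x) (1, 0) =
          -((n + 1 : ℕ) : ℝ) * (ρ s x ^ n * diverg (fun y => ρ s y •
          gradient (fun w => diverg (z s) w + ε / (ρ s w - c) ^ 2) y) x) := by
        intro x
        have h1 := hpde s hs' x
        rw [(hder s hs x).deriv] at h1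
        rw [eq_neg_of_add_eq_zero_left h1]
        ring
      simp_rw [heq]
      rw [integral_const_mul]
      exact mul_nonpos_of_nonpos_of_nonneg (neg_nonpos.2 (Nat.cast_nonneg _)) hk
  intro t ht
  have hpos : ∀ t ∈ Set.Icc (0 : ℝ) T, ∀ x, 0 < ρ t x := fun t ht x => hc.trans_lt (hρc t ht x)
  refine TVMax.limit_arg hβ0 (hsl t ht).continuous (hρper t ht) (hpos t ht) fun n => ?_
  refine (hanti n h00 ht ht.1).trans ?_
  exact integral_mono (TVMax.integ ((hsl 0 h00).continuous.pow _)) (integrable_const _)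
    fun x => pow_le_pow_left₀ (hpos 0 h00 x).le (h0 x) _

end
end
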